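/- arXiv:2211.00289 — 2 statements merged into one kernel-verified Lean document; each statement's English description precedes it below -/
import Mathlib

section
/- Let μ be a strongly Rayleigh function on the k-element subsets of {1,…,n} with full support, let ζ ≥ 1, let V ⊆ {1,…,n}, and let U be a k-element ζ-approximate local optimum of μ inside V. Then U is value-preserving with respect to the function μ̂ defined on k-element sets by μ̂(S) = (ζk)^{2|U∩S|}·μ(S). -/
open Finset

/-- A function `μ` assigning a nonnegative real to each `k`-element subset of `{1,…,n}`
is strongly Rayleigh if its generating polynomial
`g_μ(z) = Σ_{|S|=k} μ(S)·Π_{i∈S} z_i` has no complex zero with all coordinates in the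
open upper half plane. -/
def StronglyRayleigh (n k : ℕ) (μ : Finset (Fin n) → ℝ) : Prop :=
  (∀ S : Finset (Fin n), S.card = k → 0 ≤ μ S) ∧
  ∀ z : Fin n → ℂ, (∀ i, 0 < (z i).im) →
    (∑ S ∈ Finset.powersetCard k (Finset.univ : Finset (Fin n)),
      (μ S : ℂ) * ∏ i ∈ S, z i) ≠ 0

/-- A `k`-element set `U ⊆ V` is a `ζ`-approximate local optimum of `μ` inside `V` if
`ζ·μ(U) ≥ μ((U∖{e})∪{f})` for every `e ∈ U` and `f ∈ V∖U`. -/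
def ApproxLocalOpt (n k : ℕ) (ζ : ℝ) (μ : Finset (Fin n) → ℝ)
    (V U : Finset (Fin n)) : Prop :=
  U ⊆ V ∧ U.card = k ∧
    ∀ e ∈ U, ∀ f ∈ V \ U, μ (insert f (U.erase e)) ≤ ζ * μ U

/-- `U ⊆ V` is value-preserving with respect to `μ̂` if for every `k`-element set `S`
and every `e ∈ S ∩ V` there exists `f ∈ U ∖ (S ∖ {e})` with `μ̂ S ≤ μ̂ ((S∖{e})∪{f})`. -/
def ValuePreserving (n k : ℕ) (μh : Finset (Fin n) → ℝ)
    (V U : Finset (Fin n)) : Prop :=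
  U ⊆ V ∧ ∀ S : Finset (Fin n), S.card = k → ∀ e ∈ S ∩ V,
    ∃ f ∈ U \ (S.erase e), μh S ≤ μh (insert f (S.erase e))

/-- The sum `Σ_{e ∈ T, |T| = k} μ(T)·Π_{i ∈ T∖{e}} z_i`, i.e. `∂g_μ/∂z_e`. -/
def linkSum {R : Type*} [CommSemiring R] {n : ℕ} (k : ℕ) (μ : Finset (Fin n) → R) (e : Fin n)
    (z : Fin n → R) : R :=
  ∑ T ∈ (powersetCard k (univ : Finset (Fin n))).filter (e ∈ ·), μ T * ∏ i ∈ T.erase e, z i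

/-- The sum `Σ_{e ∉ T, |T| = k} μ(T)·Π_{i ∈ T} z_i`, i.e. `g_μ` at `z_e = 0`. -/
def deletionSum {R : Type*} [CommSemiring R] {n : ℕ} (k : ℕ) (μ : Finset (Fin n) → R) (e : Fin n)
    (z : Fin n → R) : R :=
  ∑ T ∈ (powersetCard k (univ : Finset (Fin n))).filter (e ∉ ·), μ T * ∏ i ∈ T, z i

lemma sum_powersetCard_eq_linkSum_add_deletionSum {R : Type*} [CommSemiring R] {n k : ℕ}
    (μ : Finset (Fin n) → R) (e : Fin n) (z : Fin n → R) (s : R) :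
    ∑ T ∈ powersetCard k (univ : Finset (Fin n)), μ T * ∏ i ∈ T, (if i = e then s else z i) =
      s * linkSum k μ e z + deletionSum k μ e z := by
  rw [← sum_filter_add_sum_filter_not _ (e ∈ ·), linkSum, deletionSum, mul_sum]
  congr 1
  · refine sum_congr rfl fun T hT => ?_
    have he : e ∈ T := (mem_filter.1 hT).2
    rw [← mul_prod_erase _ _ he, if_pos rfl,
      prod_congr rfl fun i hi => if_neg (ne_of_mem_erase hi)]
    ring
  · refine sum_congr rfl fun T hT => ?_
    have he : e ∉ T := (mem_filter.1 hT).2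
    rw [prod_congr rfl fun i hi => if_neg (ne_of_mem_of_not_mem hi he)]

/-- Homogeneity allows the open upper half plane to be replaced by any open half plane
`{w | Im (c·w) > 0}` with the origin on its boundary. -/
lemma StronglyRayleigh.linkSum_add_deletionSum_ne_zero {n k : ℕ} {μ : Finset (Fin n) → ℝ}
    (hμ : StronglyRayleigh n k μ) (e : Fin n) (z : Fin n → ℂ) (s c : ℂ)
    (hs : 0 < (c * s).im) (hz : ∀ i, 0 < (c * z i).im) :
    s * linkSum k (fun T => (μ T : ℂ)) e z + deletionSum k (fun T => (μ T : ℂ)) e z ≠ 0 := by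
  rw [← sum_powersetCard_eq_linkSum_add_deletionSum]
  intro h
  refine hμ.2 (fun i => c * if i = e then s else z i) (fun i => ?_) ?_
  · split_ifs
    exacts [hs, hz i]
  · rw [← mul_zero (c ^ k), ← h, mul_sum]
    refine sum_congr rfl fun T hT => ?_
    rw [prod_mul_distrib, prod_const, (mem_powersetCard.1 hT).2]
    ring

lemma antitoneOn_re_of_im_nonpos {G : ℂ → ℂ}
    (hd : ∀ t : ℝ, 0 < t → DifferentiableAt ℂ G t) (hreal : ∀ t : ℝ, 0 < t → (G t).im = 0)
    (him : ∀ w : ℂ, 0 < w.im → (G w).im ≤ 0) :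
    AntitoneOn (fun t : ℝ => (G t).re) (Set.Ioi 0) := by
  have hder : ∀ t : ℝ, 0 < t → HasDerivAt (fun t : ℝ => (G t).re) (deriv G t).re t :=
    fun t ht => (hd t ht).hasDerivAt.real_of_complex
  refine antitoneOn_of_deriv_nonpos (convex_Ioi 0)
    (fun t ht => (hder t ht).continuousAt.continuousWithinAt)
    (fun t ht => (hder t (interior_subset ht)).differentiableAt.differentiableWithinAt) ?_
  intro t ht
  rw [interior_Ioi] at ht
  rw [(hder t ht).deriv]
  have hline : HasDerivAt (fun x : ℝ => (t : ℂ) + x * Complex.I) Complex.I 0 := by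
    simpa using
      ((Complex.ofRealCLM.hasDerivAt (x := (0 : ℝ))).mul_const Complex.I).const_add (t : ℂ)
  have hcomp : HasDerivAt (fun x : ℝ => G ((t : ℂ) + x * Complex.I))
      (deriv G t * Complex.I) 0 := by
    refine HasDerivAt.comp (h₂ := G) (0 : ℝ) ?_ hline
    simpa using (hd t ht).hasDerivAt
  have him' : HasDerivAt (fun x : ℝ => (G ((t : ℂ) + x * Complex.I)).im) (deriv G t).re 0 := by
    simpa [Function.comp_def] using Complex.imCLM.hasFDerivAt.comp_hasDerivAt (0 : ℝ) hcomp
  have hslope := him'.tendsto_slope.mono_left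
    (nhdsWithin_mono (0 : ℝ) (s := Set.Ioi 0) fun x hx => ne_of_gt hx)
  refine le_of_tendsto hslope ?_
  filter_upwards [self_mem_nhdsWithin] with x hx
  have hx : (0 : ℝ) < x := hx
  have h0 : (G ((t : ℂ) + ((0 : ℝ) : ℂ) * Complex.I)).im = 0 := by simpa using hreal t ht
  rw [slope_def_field, h0, sub_zero, sub_zero]
  exact div_nonpos_of_nonpos_of_nonneg (him _ (by simpa using hx)) hx.le

lemma ofReal_linkSum {n k : ℕ} (μ : Finset (Fin n) → ℝ) (e : Fin n) (y : Fin n → ℝ) :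
    linkSum k (fun T => (μ T : ℂ)) e (fun i => (y i : ℂ)) = ((linkSum k μ e y : ℝ) : ℂ) := by
  simp [linkSum]

lemma ofReal_deletionSum {n k : ℕ} (μ : Finset (Fin n) → ℝ) (e : Fin n) (y : Fin n → ℝ) :
    deletionSum k (fun T => (μ T : ℂ)) e (fun i => (y i : ℂ)) = ((deletionSum k μ e y : ℝ) : ℂ) := by
  simp [deletionSum]

/-- Scaling the variables in `B` by `w` turns `g_μ(y)|_{z_e = 0} / (w·∂_e g_μ(y))` into a
function of `w` mapping the upper half plane into the closed lower half plane. -/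
lemma StronglyRayleigh.im_deletionSum_div_linkSum_nonpos {n k : ℕ} {μ : Finset (Fin n) → ℝ}
    (hμ : StronglyRayleigh n k μ) (e : Fin n) (B : Finset (Fin n)) {u : Fin n → ℝ}
    (hu : ∀ i, 0 < u i) {w : ℂ} (hw : 0 < w.im) :
    (deletionSum k (fun T => (μ T : ℂ)) e (fun i => if i ∈ B then w * u i else u i) /
      (w * linkSum k (fun T => (μ T : ℂ)) e (fun i => if i ∈ B then w * u i else u i))).im ≤ 0 := by
  set y : Fin n → ℂ := fun i => if i ∈ B then w * u i else u i
  set P := linkSum k (fun T => (μ T : ℂ)) e y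
  set Q := deletionSum k (fun T => (μ T : ℂ)) e y
  by_contra! hG
  have hw0 : w ≠ 0 := by rintro rfl; simp at hw
  have hP : P ≠ 0 := by
    intro hP
    simp [hP] at hG
  set G := Q / (w * P)
  have hinv : 0 < (-w⁻¹).im := by
    simpa [Complex.inv_im, neg_div] using div_pos hw (Complex.normSq_pos.2 hw0)
  obtain ⟨δ, hδ, hδ1, hδ2⟩ : ∃ δ : ℝ, 0 < δ ∧ 0 < ((-1 + δ * Complex.I) * w⁻¹).im ∧
      0 < ((-1 + δ * Complex.I) * -G).im := by
    have h1 : Filter.Tendsto (fun δ : ℝ => ((-1 + δ * Complex.I) * w⁻¹).im)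
        (nhdsWithin 0 (Set.Ioi 0)) (nhds (-w⁻¹).im) := by
      have : Continuous (fun δ : ℝ => ((-1 + δ * Complex.I) * w⁻¹).im) := by fun_prop
      refine (this.tendsto' 0 _ (by simp)).mono_left nhdsWithin_le_nhds
    have h2 : Filter.Tendsto (fun δ : ℝ => ((-1 + δ * Complex.I) * -G).im)
        (nhdsWithin 0 (Set.Ioi 0)) (nhds G.im) := by
      have : Continuous (fun δ : ℝ => ((-1 + δ * Complex.I) * -G).im) := by fun_prop
      refine (this.tendsto' 0 _ (by simp)).mono_left nhdsWithin_le_nhds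
    obtain ⟨δ, h, h', h''⟩ := ((h1.eventually (lt_mem_nhds hinv)).and
      ((h2.eventually (lt_mem_nhds hG)).and self_mem_nhdsWithin)).exists
    exact ⟨δ, h'', h, h'⟩
  refine hμ.linkSum_add_deletionSum_ne_zero e y (-(w * G)) ((-1 + δ * Complex.I) * w⁻¹) ?_ ?_ ?_
  · convert hδ2 using 2
    field_simp
  · intro i
    by_cases hi : i ∈ B
    · have : (-1 + δ * Complex.I) * w⁻¹ * y i = (-1 + δ * Complex.I) * u i := by
        simp only [y, if_pos hi]
        field_simp
      rw [this, Complex.im_mul_ofReal]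
      exact mul_pos (by simpa using hδ) (hu i)
    · simp only [y, if_neg hi]
      rw [Complex.im_mul_ofReal]
      exact mul_pos hδ1 (hu i)
  · change -(w * G) * P + Q = 0
    simp only [G]
    field_simp
    ring

lemma linkSum_pos {n k : ℕ} {μ : Finset (Fin n) → ℝ}
    (hfull : ∀ S : Finset (Fin n), S.card = k → 0 < μ S) {e : Fin n} {S : Finset (Fin n)}
    (hS : S.card = k) (he : e ∈ S) {y : Fin n → ℝ} (hy : ∀ i, 0 < y i) : 0 < linkSum k μ e y :=
  sum_pos (fun T hT => mul_pos (hfull T (mem_powersetCard.1 (mem_filter.1 hT).1).2)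
    (prod_pos fun i _ => hy i)) ⟨S, by simp [hS, he]⟩

lemma StronglyRayleigh.deletionSum_mul_linkSum_le {n k : ℕ} {μ : Finset (Fin n) → ℝ}
    (hμ : StronglyRayleigh n k μ) (hfull : ∀ S : Finset (Fin n), S.card = k → 0 < μ S)
    {e : Fin n} {S : Finset (Fin n)} (hS : S.card = k) (he : e ∈ S) (B : Finset (Fin n))
    {u : Fin n → ℝ} (hu : ∀ i, 0 < u i) {l : ℝ} (hl : 1 ≤ l) :
    deletionSum k μ e (fun i => if i ∈ B then l * u i else u i) * linkSum k μ e u ≤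
      l * (deletionSum k μ e u * linkSum k μ e (fun i => if i ∈ B then l * u i else u i)) := by
  set y : ℝ → Fin n → ℝ := fun t i => if i ∈ B then t * u i else u i
  have hy : ∀ t, 0 < t → ∀ i, 0 < y t i := fun t ht i => by
    simp only [y]
    split_ifs
    exacts [mul_pos ht (hu i), hu i]
  have hy1 : y 1 = u := by simp [y]
  set yc : ℂ → Fin n → ℂ := fun w i => if i ∈ B then w * u i else u i
  have hyc : ∀ t : ℝ, yc t = fun i => (y t i : ℂ) := fun t => by
    ext i
    simp only [yc, y]
    split_ifs <;> simp
  set G : ℂ → ℂ := fun w => deletionSum k (fun T => (μ T : ℂ)) e (yc w) /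
    (w * linkSum k (fun T => (μ T : ℂ)) e (yc w))
  have hG : ∀ t : ℝ, G t = ((deletionSum k μ e (y t) / (t * linkSum k μ e (y t)) : ℝ) : ℂ) :=
    fun t => by
      simp only [G]
      rw [hyc, ofReal_linkSum, ofReal_deletionSum]
      push_cast
      rfl
  have hydiff : ∀ i, Differentiable ℂ fun w => yc w i := fun i => by
    simp only [yc]
    split_ifs <;> fun_prop
  have hanti := antitoneOn_re_of_im_nonpos (G := G) (fun t ht => ?_) (fun t _ => by rw [hG, Complex.ofReal_im])
    (fun w hw => hμ.im_deletionSum_div_linkSum_nonpos e B hu hw)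
  · have hl0 : 0 < l := by linarith
    have h := hanti (Set.mem_Ioi.2 one_pos) (Set.mem_Ioi.2 hl0) hl
    simp only [hG, Complex.ofReal_re, hy1, one_mul] at h
    have hp := linkSum_pos hfull hS he hu
    have hq := linkSum_pos hfull hS he (hy l hl0)
    rw [div_le_div_iff₀ (by positivity) hp] at h
    linarith
  · have hne : (t : ℂ) * linkSum k (fun T => (μ T : ℂ)) e (yc t) ≠ 0 := by
      rw [hyc, ofReal_linkSum]
      exact_mod_cast (mul_pos ht (linkSum_pos hfull hS he (hy t ht))).ne'
    refine DifferentiableAt.div ?_ (differentiableAt_id.mul ?_) hne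
    · simp only [deletionSum]
      fun_prop
    · simp only [linkSum]
      fun_prop

lemma sum_mul_pow_eq {ι : Type*} (F : Finset ι) (a : ι → ℝ) (h : ι → ℕ) {m : ℕ}
    (hm : ∀ T ∈ F, m ≤ h T) (x : ℝ) :
    ∑ T ∈ F, a T * x ^ h T = x ^ m * ∑ T ∈ F, a T * x ^ (h T - m) := by
  rw [mul_sum]
  refine sum_congr rfl fun T hT => ?_
  rw [mul_left_comm, ← pow_add, Nat.add_sub_cancel' (hm T hT)]

lemma le_sum_mul_zero_pow {ι : Type*} {F : Finset ι} {a : ι → ℝ} (ha : ∀ T ∈ F, 0 ≤ a T)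
    (h : ι → ℕ) {m : ℕ} {T₀ : ι} (hT₀ : T₀ ∈ F) (hm : h T₀ = m) :
    a T₀ ≤ ∑ T ∈ F, a T * (0 : ℝ) ^ (h T - m) := by
  have := single_le_sum (f := fun T => a T * (0 : ℝ) ^ (h T - m))
    (fun T hT => mul_nonneg (ha T hT) (by positivity)) hT₀
  simpa [hm] using this

lemma sum_mul_zero_pow_le {ι κ : Type*} [DecidableEq ι] {F : Finset ι} {a : ι → ℝ}
    (h : ι → ℕ) {m : ℕ} (hm : ∀ T ∈ F, m ≤ h T) {J : Finset κ} {φ : κ → ι}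
    (hφ : ∀ j ∈ J, 0 ≤ a (φ j)) (himg : ∀ T ∈ F, h T = m → T ∈ J.image φ) :
    ∑ T ∈ F, a T * (0 : ℝ) ^ (h T - m) ≤ ∑ j ∈ J, a (φ j) := by
  calc ∑ T ∈ F, a T * (0 : ℝ) ^ (h T - m) = ∑ T ∈ F.filter (h · = m), a T := by
        rw [sum_filter]
        refine sum_congr rfl fun T hT => ?_
        have := hm T hT
        split_ifs with hT'
        · simp [hT']
        · rw [zero_pow (by omega), mul_zero]
    _ ≤ ∑ T ∈ J.image φ, a T := by
        refine sum_le_sum_of_subset_of_nonneg (fun T hT => ?_) fun T hT _ => ?_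
        · exact himg T (mem_filter.1 hT).1 (mem_filter.1 hT).2
        · obtain ⟨j, hj, rfl⟩ := mem_image.1 hT
          exact hφ j hj
    _ ≤ ∑ j ∈ J, a (φ j) := sum_image_le_of_nonneg (by simpa using hφ)

/-- Weights of the variables which single out, as the common scale tends to `0`, the sets
obtained from `S` and `U` by exchanging at most one element. -/
def exchangeWeight {n : ℕ} (S U : Finset (Fin n)) (m : ℕ) (i : Fin n) : ℕ :=
  if i ∈ S then (if i ∈ U then 0 else 2) else (if i ∈ U then m else 4)

section ExchangeWeight

variable {n : ℕ} {S U T : Finset (Fin n)} {e : Fin n}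

lemma sum_exchangeWeight (S U T : Finset (Fin n)) (m : ℕ) :
    ∑ i ∈ T, exchangeWeight S U m i =
      2 * (T ∩ (S \ U)).card + m * (T ∩ (U \ S)).card + 4 * (T \ (S ∪ U)).card := by
  have h1 : T ∩ (S \ U) = T.filter (fun i => i ∈ S ∧ i ∉ U) := by ext; simp
  have h2 : T ∩ (U \ S) = T.filter (fun i => i ∈ U ∧ i ∉ S) := by ext; simp
  have h3 : T \ (S ∪ U) = T.filter (fun i => i ∉ S ∧ i ∉ U) := by ext; simp
  rw [h1, h2, h3, card_filter, card_filter, card_filter, mul_sum, mul_sum, mul_sum,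
    ← sum_add_distrib, ← sum_add_distrib]
  refine sum_congr rfl fun i _ => ?_
  by_cases hS : i ∈ S <;> by_cases hU : i ∈ U <;> simp [exchangeWeight, hS, hU]

lemma card_eq_add_of_inter (S U T : Finset (Fin n)) :
    T.card = (T ∩ (S ∩ U)).card + (T ∩ (S \ U)).card + (T ∩ (U \ S)).card +
      (T \ (S ∪ U)).card := by
  have h0 : T ∩ (S ∩ U) = T.filter (fun i => i ∈ S ∧ i ∈ U) := by ext; simp
  have h1 : T ∩ (S \ U) = T.filter (fun i => i ∈ S ∧ i ∉ U) := by ext; simp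
  have h2 : T ∩ (U \ S) = T.filter (fun i => i ∈ U ∧ i ∉ S) := by ext; simp
  have h3 : T \ (S ∪ U) = T.filter (fun i => i ∉ S ∧ i ∉ U) := by ext; simp
  rw [h0, h1, h2, h3, card_filter, card_filter, card_filter, card_filter,
    ← sum_add_distrib, ← sum_add_distrib, ← sum_add_distrib, card_eq_sum_ones]
  refine sum_congr rfl fun i _ => ?_
  by_cases hS : i ∈ S <;> by_cases hU : i ∈ U <;> simp [hS, hU]

lemma le_sum_exchangeWeight_erase (hST : T.card = S.card) (heT : e ∈ T) :
    2 * ((S \ U).card - 1) ≤ ∑ i ∈ T.erase e, exchangeWeight S U 3 i := by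
  have h1 := card_eq_add_of_inter S U (T.erase e)
  have h2 := card_le_card (inter_subset_right : (T.erase e) ∩ (S ∩ U) ⊆ S ∩ U)
  have h3 := card_sdiff_add_card_inter S U
  rw [card_erase_of_mem heT] at h1
  rw [sum_exchangeWeight]
  omega

lemma sum_exchangeWeight_erase_self (heS : e ∈ S) (heU : e ∉ U) :
    ∑ i ∈ S.erase e, exchangeWeight S U 3 i = 2 * ((S \ U).card - 1) := by
  have h1 : S.erase e ∩ (S \ U) = (S \ U).erase e := by ext; simp
  have h2 : S.erase e ∩ (U \ S) = ∅ := by ext; simp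
  have h3 : S.erase e \ (S ∪ U) = ∅ := by ext; simp; tauto
  rw [sum_exchangeWeight, h1, h2, h3, card_erase_of_mem (by simp [heS, heU])]
  simp

lemma card_inter_sdiff_le_of_notMem (heS : e ∈ S) (heU : e ∉ U) (heT : e ∉ T) :
    (T ∩ (S \ U)).card ≤ (S \ U).card - 1 := by
  rw [← card_erase_of_mem (mem_sdiff.2 ⟨heS, heU⟩)]
  refine card_le_card fun i hi => mem_erase.2 ⟨?_, (mem_inter.1 hi).2⟩
  rintro rfl
  exact heT (mem_inter.1 hi).1

lemma le_sum_exchangeWeight (hST : T.card = S.card) (heS : e ∈ S) (heU : e ∉ U) (heT : e ∉ T) :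
    2 * (S \ U).card + 1 ≤ ∑ i ∈ T, exchangeWeight S U 3 i := by
  have h1 := card_eq_add_of_inter S U T
  have h2 := card_le_card (inter_subset_right : T ∩ (S ∩ U) ⊆ S ∩ U)
  have h3 := card_sdiff_add_card_inter S U
  have h4 := card_inter_sdiff_le_of_notMem heS heU heT
  have h5 := card_pos.2 ⟨e, mem_sdiff.2 ⟨heS, heU⟩⟩
  rw [sum_exchangeWeight]
  omega

lemma mem_image_of_sum_exchangeWeight_eq (hST : T.card = S.card) (heS : e ∈ S) (heU : e ∉ U)
    (heT : e ∉ T) (h : ∑ i ∈ T, exchangeWeight S U 3 i = 2 * (S \ U).card + 1) :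
    T ∈ (U \ S).image fun f => insert f (S.erase e) := by
  have h1 := card_eq_add_of_inter S U T
  have h2 := card_le_card (inter_subset_right : T ∩ (S ∩ U) ⊆ S ∩ U)
  have h3 := card_sdiff_add_card_inter S U
  have h4 := card_inter_sdiff_le_of_notMem heS heU heT
  have h5 := card_pos.2 ⟨e, mem_sdiff.2 ⟨heS, heU⟩⟩
  rw [sum_exchangeWeight] at h
  have hb : (T ∩ (U \ S)).card = 1 := by omega
  have ho : (T \ (S ∪ U)).card = 0 := by omega
  obtain ⟨f, hf⟩ := card_eq_one.1 hb
  have hfm : f ∈ T ∩ (U \ S) := by simp [hf]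
  rw [mem_inter, mem_sdiff] at hfm
  refine mem_image.2 ⟨f, mem_sdiff.2 hfm.2, (eq_of_subset_of_card_le (fun i hi => ?_) ?_).symm⟩
  · by_cases hiS : i ∈ S
    · exact mem_insert_of_mem (mem_erase.2 ⟨ne_of_mem_of_not_mem hi heT, hiS⟩)
    · have hiU : i ∈ U := by
        by_contra hiU
        rw [card_eq_zero] at ho
        have : i ∈ T \ (S ∪ U) := by simp [hi, hiS, hiU]
        simp [ho] at this
      have : i ∈ T ∩ (U \ S) := by simp [hi, hiS, hiU]
      rw [hf, mem_singleton] at this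
      simp [this]
  · have := card_insert_le f (S.erase e)
    rw [card_erase_of_mem heS] at this
    have := card_pos.2 ⟨e, heS⟩
    omega

lemma le_sum_exchangeWeight_one (hST : T.card = S.card) :
    (S \ U).card ≤ ∑ i ∈ T, exchangeWeight S U 1 i := by
  have h1 := card_eq_add_of_inter S U T
  have h2 := card_le_card (inter_subset_right : T ∩ (S ∩ U) ⊆ S ∩ U)
  have h3 := card_sdiff_add_card_inter S U
  rw [sum_exchangeWeight]
  omega

lemma sum_exchangeWeight_one_self (hSU : U.card = S.card) :
    ∑ i ∈ U, exchangeWeight S U 1 i = (S \ U).card := by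
  have h1 : U ∩ (S \ U) = ∅ := by ext; simp
  have h2 : U ∩ (U \ S) = U \ S := by ext; simp
  have h3 : U \ (S ∪ U) = ∅ := by ext; simp; tauto
  rw [sum_exchangeWeight, h1, h2, h3, card_sdiff_comm hSU]
  simp

lemma le_sum_exchangeWeight_one_erase (hST : T.card = S.card) (heT : e ∈ T) :
    (S \ U).card - 1 ≤ ∑ i ∈ T.erase e, exchangeWeight S U 1 i := by
  have h1 := card_eq_add_of_inter S U (T.erase e)
  have h2 := card_le_card (inter_subset_right : (T.erase e) ∩ (S ∩ U) ⊆ S ∩ U)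
  have h3 := card_sdiff_add_card_inter S U
  rw [card_erase_of_mem heT] at h1
  rw [sum_exchangeWeight]
  omega

lemma mem_image_of_sum_exchangeWeight_one_erase_eq (hST : T.card = S.card)
    (hSU : U.card = S.card) (heS : e ∈ S) (heU : e ∉ U) (heT : e ∈ T)
    (h : ∑ i ∈ T.erase e, exchangeWeight S U 1 i = (S \ U).card - 1) :
    T ∈ U.image fun f => insert e (U.erase f) := by
  have h1 := card_eq_add_of_inter S U (T.erase e)
  have h2 := card_le_card (inter_subset_right : (T.erase e) ∩ (S ∩ U) ⊆ S ∩ U)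
  have h3 := card_sdiff_add_card_inter S U
  have h4 := card_pos.2 ⟨e, heS⟩
  have h5 := card_pos.2 ⟨e, mem_sdiff.2 ⟨heS, heU⟩⟩
  have hTe := card_erase_of_mem heT
  rw [sum_exchangeWeight] at h
  have ha : (T.erase e ∩ (S \ U)).card = 0 := by omega
  have ho : (T.erase e \ (S ∪ U)).card = 0 := by omega
  rw [card_eq_zero] at ha ho
  have hsub : T.erase e ⊆ U := fun i hi => by
    by_contra hiU
    by_cases hiS : i ∈ S
    · have : i ∈ T.erase e ∩ (S \ U) := mem_inter.2 ⟨hi, mem_sdiff.2 ⟨hiS, hiU⟩⟩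
      simp [ha] at this
    · have : i ∈ T.erase e \ (S ∪ U) := mem_sdiff.2 ⟨hi, by simp [hiS, hiU]⟩
      simp [ho] at this
  have hdiff : (U \ T.erase e).card = 1 := by
    rw [card_sdiff_of_subset hsub]
    omega
  obtain ⟨f, hf⟩ := card_eq_one.1 hdiff
  have hfm : f ∈ U \ T.erase e := by simp [hf]
  refine mem_image.2 ⟨f, (mem_sdiff.1 hfm).1, ?_⟩
  rw [erase_eq, ← hf, Finset.sdiff_sdiff_eq_self hsub, insert_erase heT]

end ExchangeWeight

/-- An exchange inequality for strongly Rayleigh functions. -/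
lemma StronglyRayleigh.mul_le_sum_mul_sum {n k : ℕ} {μ : Finset (Fin n) → ℝ}
    (hμ : StronglyRayleigh n k μ) (hfull : ∀ S : Finset (Fin n), S.card = k → 0 < μ S)
    {S U : Finset (Fin n)} (hS : S.card = k) (hU : U.card = k) {e : Fin n}
    (heS : e ∈ S) (heU : e ∉ U) :
    μ U * μ S ≤ (∑ f ∈ U \ S, μ (insert f (S.erase e))) *
      ∑ f ∈ U, μ (insert e (U.erase f)) := by
  have hSU : U.card = S.card := hU.trans hS.symm
  set r := (S \ U).card
  have hr : 0 < r := card_pos.2 ⟨e, mem_sdiff.2 ⟨heS, heU⟩⟩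
  set L := (powersetCard k (univ : Finset (Fin n))).filter (e ∈ ·)
  set D := (powersetCard k (univ : Finset (Fin n))).filter (e ∉ ·)
  have hL : ∀ T ∈ L, T.card = S.card ∧ e ∈ T := fun T hT => by
    simpa [L, hS] using hT
  have hD : ∀ T ∈ D, T.card = S.card ∧ e ∉ T := fun T hT => by
    simpa [D, hS] using hT
  have hposL : ∀ T ∈ L, 0 ≤ μ T := fun T hT => (hfull T ((hL T hT).1.trans hS)).le
  have hposD : ∀ T ∈ D, 0 ≤ μ T := fun T hT => (hfull T ((hD T hT).1.trans hS)).le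
  set p : ℕ → Finset (Fin n) → ℕ := fun m T => ∑ i ∈ T.erase e, exchangeWeight S U m i
  set q : ℕ → Finset (Fin n) → ℕ := fun m T => ∑ i ∈ T, exchangeWeight S U m i
  have hp3 : ∀ T ∈ L, 2 * (r - 1) ≤ p 3 T := fun T hT =>
    le_sum_exchangeWeight_erase (hL T hT).1 (hL T hT).2
  have hq3 : ∀ T ∈ D, 2 * r + 1 ≤ q 3 T := fun T hT =>
    le_sum_exchangeWeight (hD T hT).1 heS heU (hD T hT).2
  have hp1 : ∀ T ∈ L, r - 1 ≤ p 1 T := fun T hT =>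
    le_sum_exchangeWeight_one_erase (hL T hT).1 (hL T hT).2
  have hq1 : ∀ T ∈ D, r ≤ q 1 T := fun T hT => le_sum_exchangeWeight_one (hD T hT).1
  set P : ℕ → ℕ → ℝ → ℝ := fun m h x => ∑ T ∈ L, μ T * x ^ (p m T - h)
  set Q : ℕ → ℕ → ℝ → ℝ := fun m h x => ∑ T ∈ D, μ T * x ^ (q m T - h)
  have hlink : ∀ m h x, (∀ T ∈ L, h ≤ p m T) →
      linkSum k μ e (fun i => x ^ exchangeWeight S U m i) = x ^ h * P m h x :=
    fun m h x hh => by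
      simp only [linkSum, prod_pow_eq_pow_sum]
      exact sum_mul_pow_eq L μ (p m) hh x
  have hdel : ∀ m h x, (∀ T ∈ D, h ≤ q m T) →
      deletionSum k μ e (fun i => x ^ exchangeWeight S U m i) = x ^ h * Q m h x :=
    fun m h x hh => by
      simp only [deletionSum, prod_pow_eq_pow_sum]
      exact sum_mul_pow_eq D μ (q m) hh x
  have key : ∀ x : ℝ, 0 < x → x < 1 →
      Q 1 r x * P 3 (2 * (r - 1)) x ≤ Q 3 (2 * r + 1) x * P 1 (r - 1) x := by
    intro x hx hx1
    have h := hμ.deletionSum_mul_linkSum_le hfull hS heS (U \ S)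
      (u := fun i => x ^ exchangeWeight S U 3 i) (fun i => by positivity) (l := (x ^ 2)⁻¹)
      ((one_le_inv₀ (by positivity)).2 (by nlinarith))
    have hv : (fun i => if i ∈ U \ S then (x ^ 2)⁻¹ * x ^ exchangeWeight S U 3 i else
        x ^ exchangeWeight S U 3 i) = fun i => x ^ exchangeWeight S U 1 i := by
      ext i
      by_cases hiS : i ∈ S <;> by_cases hiU : i ∈ U <;> simp [exchangeWeight, hiS, hiU]
      field_simp
    rw [hv, hlink 3 _ x hp3, hlink 1 _ x hp1, hdel 3 _ x hq3, hdel 1 _ x hq1] at h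
    obtain ⟨s, hs⟩ : ∃ s, r = s + 1 := ⟨r - 1, by omega⟩
    rw [hs] at h ⊢
    simp only [Nat.add_sub_cancel] at h ⊢
    refine le_of_mul_le_mul_left ?_ (show 0 < x ^ (3 * s + 1) by positivity)
    calc _ = _ := ?_
      _ ≤ _ := h
      _ = _ := ?_
    · ring
    · field_simp
      ring
  have hPc : ∀ m h, Continuous (P m h) := fun m h => by simp only [P]; fun_prop
  have hQc : ∀ m h, Continuous (Q m h) := fun m h => by simp only [Q]; fun_prop
  have hlim : Q 1 r 0 * P 3 (2 * (r - 1)) 0 ≤ Q 3 (2 * r + 1) 0 * P 1 (r - 1) 0 := by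
    refine le_of_tendsto_of_tendsto (b := nhdsWithin (0 : ℝ) (Set.Ioi 0))
      (((hQc 1 r).mul (hPc 3 (2 * (r - 1)))).continuousAt.tendsto.mono_left nhdsWithin_le_nhds)
      (((hQc 3 (2 * r + 1)).mul (hPc 1 (r - 1))).continuousAt.tendsto.mono_left
        nhdsWithin_le_nhds) ?_
    filter_upwards [Ioo_mem_nhdsGT (zero_lt_one' ℝ)] with x hx
    exact key x hx.1 hx.2
  have hU0 : μ U ≤ Q 1 r 0 :=
    le_sum_mul_zero_pow hposD (q 1) (by simp [D, hU, heU]) (sum_exchangeWeight_one_self hSU)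
  have hS0 : μ S ≤ P 3 (2 * (r - 1)) 0 :=
    le_sum_mul_zero_pow hposL (p 3) (by simp [L, hS, heS]) (sum_exchangeWeight_erase_self heS heU)
  have hcard1 : ∀ f ∈ U \ S, 0 ≤ μ (insert f (S.erase e)) := fun f hf => by
    refine (hfull _ ?_).le
    rw [card_insert_of_notMem (by simp [(mem_sdiff.1 hf).2]), card_erase_add_one heS, hS]
  have hcard2 : ∀ f ∈ U, 0 ≤ μ (insert e (U.erase f)) := fun f hf => by
    refine (hfull _ ?_).le
    rw [card_insert_of_notMem (by simp [heU]), card_erase_add_one hf, hU]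
  have hQ0 : Q 3 (2 * r + 1) 0 ≤ ∑ f ∈ U \ S, μ (insert f (S.erase e)) :=
    sum_mul_zero_pow_le (q 3) hq3 hcard1 fun T hT h =>
      mem_image_of_sum_exchangeWeight_eq (hD T hT).1 heS heU (hD T hT).2 h
  have hP0 : P 1 (r - 1) 0 ≤ ∑ f ∈ U, μ (insert e (U.erase f)) :=
    sum_mul_zero_pow_le (p 1) hp1 hcard2 fun T hT h =>
      mem_image_of_sum_exchangeWeight_one_erase_eq (hL T hT).1 hSU heS heU (hL T hT).2 h
  calc μ U * μ S ≤ Q 1 r 0 * P 3 (2 * (r - 1)) 0 :=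
        mul_le_mul hU0 hS0 (hfull S hS).le ((hfull U hU).le.trans hU0)
    _ ≤ Q 3 (2 * r + 1) 0 * P 1 (r - 1) 0 := hlim
    _ ≤ _ := mul_le_mul hQ0 hP0
        (sum_nonneg fun T hT => mul_nonneg (hposL T hT) (by positivity)) (sum_nonneg hcard1)

/-- a `k`-element `ζ`-approximate local optimum `U` of a full-support
strongly Rayleigh `μ` inside `V` is value-preserving with respect to
`μ̂(S) = (ζk)^{2|U∩S|}·μ(S)`. -/
theorem stmt6 (n k : ℕ) (hk1 : 1 ≤ k) (hkn : k ≤ n)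
    (μ : Finset (Fin n) → ℝ) (hμ : StronglyRayleigh n k μ)
    (hfull : ∀ S : Finset (Fin n), S.card = k → 0 < μ S)
    (ζ : ℝ) (hζ : 1 ≤ ζ)
    (V U : Finset (Fin n)) (hU : ApproxLocalOpt n k ζ μ V U) :
    ValuePreserving n k (fun S => (ζ * k) ^ (2 * (U ∩ S).card) * μ S) V U := by
  obtain ⟨hUV, hUk, hopt⟩ := hU
  refine ⟨hUV, fun S hS e he => ?_⟩
  obtain ⟨heS, heV⟩ := mem_inter.1 he
  by_cases heU : e ∈ U
  · exact ⟨e, by simp [heU], by rw [insert_erase heS]⟩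
  have hk : (0 : ℝ) < k := by exact_mod_cast hk1
  have hμU := hfull U hUk
  have hcard : ((U \ S).card : ℝ) ≤ k := by
    rw [← hUk]
    exact_mod_cast card_le_card sdiff_subset
  have hne : (U \ S).Nonempty := by
    rw [← card_pos, card_sdiff_comm (hUk.trans hS.symm), card_pos]
    exact ⟨e, mem_sdiff.2 ⟨heS, heU⟩⟩
  obtain ⟨f, hf, hmax⟩ := exists_max_image (U \ S) (fun f => μ (insert f (S.erase e))) hne
  obtain ⟨hfU, hfS⟩ := mem_sdiff.1 hf
  have hfS' : f ∉ S.erase e := fun h => hfS (mem_of_mem_erase h)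
  refine ⟨f, mem_sdiff.2 ⟨hfU, hfS'⟩, ?_⟩
  set a := μ (insert f (S.erase e))
  have ha : 0 < a := hfull _ (by rw [card_insert_of_notMem hfS', card_erase_add_one heS, hS])
  have h1 : ∑ f ∈ U \ S, μ (insert f (S.erase e)) ≤ k * a :=
    (sum_le_card_nsmul _ _ a hmax).trans (by rw [nsmul_eq_mul]; gcongr)
  have h2 : ∑ f ∈ U, μ (insert e (U.erase f)) ≤ k * (ζ * μ U) :=
    (sum_le_card_nsmul _ _ _ fun g hg => hopt g hg e (mem_sdiff.2 ⟨heV, heU⟩)).trans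
      (by rw [nsmul_eq_mul, hUk])
  have h3 : μ U * μ S ≤ μ U * ((ζ * k) ^ 2 * a) :=
    calc μ U * μ S ≤ _ := hμ.mul_le_sum_mul_sum hfull hS hUk heS heU
      _ ≤ (k * a) * (k * (ζ * μ U)) := by
        refine mul_le_mul h1 h2 (sum_nonneg fun g hg => (hfull _ ?_).le) (by positivity)
        rw [card_insert_of_notMem (by simp [heU]), card_erase_add_one hg, hUk]
      _ = μ U * (k ^ 2 * a) * ζ := by ring
      _ ≤ μ U * (k ^ 2 * a) * ζ ^ 2 := by gcongr; nlinarith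
      _ = _ := by ring
  have h4 : μ S ≤ (ζ * k) ^ 2 * a := le_of_mul_le_mul_left h3 hμU
  have h5 : (U ∩ insert f (S.erase e)).card = (U ∩ S).card + 1 := by
    have : U ∩ insert f (S.erase e) = insert f (U ∩ S) := by
      rw [inter_insert_of_mem hfU, inter_erase, erase_eq_of_notMem (by simp [heU])]
    rw [this, card_insert_of_notMem (by simp [hfS])]
  simp only [h5]
  rw [mul_add, pow_add, mul_assoc]
  gcongr
end

section
/- Let μ be a strongly Rayleigh function on the k-element subsets of {1,…,n} with full support, and let ζ ≥ 1. Consider the partition matroid on {1,…,n} given by parts P_1,…,P_s and integers k_1,…,k_s ≥ 1 with rank k = Σ_i k_i, and let μ_M be the restriction of μ to its bases. For each V ⊆ {1,…,n}, let c(V) = ∪_{i=1}^s U_i(V), where U_i(V) is a k-element ζ-approximate local optimum of μ inside V∩P_i whenever |V∩P_i| ≥ k, and U_i(V) = V∩P_i otherwise. Then |c(V)| ≤ sk for every V, and c is a (ζk)^{2k}-composable coreset for maximizing μ_M over k-element sets. -/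
open Finset

/-- A map `c` with `c V ⊆ V` is an `α`-composable coreset for maximizing `μ` over
`k`-element sets: for every collection `V_1, …, V_m` and every `k`-set `S` inside the
union of the `V_i`, some `k`-set `T` inside the union of the `c (V_i)` satisfies
`μ S ≤ α · μ T`. -/
def ComposableCoreset (n k : ℕ) (α : ℝ) (μ : Finset (Fin n) → ℝ)
    (c : Finset (Fin n) → Finset (Fin n)) : Prop :=
  (∀ V, c V ⊆ V) ∧
  ∀ (m : ℕ) (Vs : Fin m → Finset (Fin n)) (S : Finset (Fin n)),
    S ⊆ Finset.univ.biUnion Vs → S.card = k →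
    ∃ T : Finset (Fin n),
      T ⊆ Finset.univ.biUnion (fun i => c (Vs i)) ∧ T.card = k ∧ μ S ≤ α * μ T

/-- The partial derivative `∂^A`, evaluated at `x`, of the multiaffine polynomial
`∑_{|S| = k} c S · ∏_{i ∈ S} x i`. -/
def multiaffineDeriv {R : Type*} [CommRing R] (n k : ℕ) (c : Finset (Fin n) → R)
    (A : Finset (Fin n)) (x : Fin n → R) : R :=
  ∑ S ∈ (powersetCard k (univ : Finset (Fin n))).filter (A ⊆ ·), c S * ∏ i ∈ S \ A, x i

section multiaffineDeriv

variable {R : Type*} [CommRing R] {n k : ℕ}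

lemma multiaffineDeriv_congr (c : Finset (Fin n) → R) (A : Finset (Fin n)) {x y : Fin n → R}
    (h : ∀ i ∉ A, x i = y i) : multiaffineDeriv n k c A x = multiaffineDeriv n k c A y := by
  unfold multiaffineDeriv
  refine sum_congr rfl fun S _ => ?_
  congr 1
  exact prod_congr rfl fun i hi => h i (mem_sdiff.1 hi).2

lemma multiaffineDeriv_eq_add (c : Finset (Fin n) → R) {A : Finset (Fin n)} {t : Fin n}
    (ht : t ∉ A) (x : Fin n → R) :
    multiaffineDeriv n k c A x = multiaffineDeriv n k c A (Function.update x t 0) +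
      x t * multiaffineDeriv n k c (insert t A) x := by
  unfold multiaffineDeriv
  have hf : (powersetCard k (univ : Finset (Fin n))).filter (insert t A ⊆ ·) =
      ((powersetCard k (univ : Finset (Fin n))).filter (A ⊆ ·)).filter (t ∈ ·) := by
    ext S
    simp only [mem_filter, insert_subset_iff]
    tauto
  rw [hf, sum_filter (s := filter _ _), mul_sum, ← sum_add_distrib]
  refine sum_congr rfl fun S _ => ?_
  by_cases hS : t ∈ S
  · have hmem : t ∈ S \ A := mem_sdiff.2 ⟨hS, ht⟩
    have h0 : ∏ i ∈ S \ A, Function.update x t 0 i = 0 :=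
      prod_eq_zero hmem (by simp)
    have h1 : S \ insert t A = (S \ A).erase t := by
      ext i
      simp only [mem_sdiff, mem_insert, mem_erase]
      tauto
    rw [h0, if_pos hS, h1, ← mul_prod_erase _ _ hmem]
    ring
  · rw [if_neg hS, mul_zero, add_zero]
    congr 1
    refine prod_congr rfl fun i hi => ?_
    rw [Function.update_of_ne]
    rintro rfl
    exact hS (mem_sdiff.1 hi).1

lemma multiaffineDeriv_empty_eq (c : Finset (Fin n) → R) {e t : Fin n} (het : e ≠ t)
    (x : Fin n → R) :
    multiaffineDeriv n k c ∅ x =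
      multiaffineDeriv n k c ∅ (Function.update (Function.update x e 0) t 0) +
      x e * multiaffineDeriv n k c {e} (Function.update x t 0) +
      x t * multiaffineDeriv n k c {t} (Function.update x e 0) +
      x e * x t * multiaffineDeriv n k c {e, t} x := by
  rw [multiaffineDeriv_eq_add c (notMem_empty e) x,
    multiaffineDeriv_eq_add c (notMem_empty t) (Function.update x e 0),
    insert_empty, insert_empty,
    multiaffineDeriv_eq_add c (A := {e}) (t := t) (by simpa using het.symm) x,
    pair_comm t e, Function.update_of_ne het.symm]
  ring

end multiaffineDeriv

lemma continuous_multiaffineDeriv {n k : ℕ} (c : Finset (Fin n) → ℂ) (A : Finset (Fin n)) :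
    Continuous (multiaffineDeriv n k c A) := by
  unfold multiaffineDeriv
  fun_prop

lemma multiaffineDeriv_ofReal {n k : ℕ} (μ : Finset (Fin n) → ℝ) (A : Finset (Fin n))
    (x : Fin n → ℝ) :
    multiaffineDeriv n k (fun S => (μ S : ℂ)) A (fun i => (x i : ℂ)) =
      ((multiaffineDeriv n k μ A x : ℝ) : ℂ) := by
  unfold multiaffineDeriv
  push_cast
  rfl

/-- A real bilinear form `a + b z + c w + d z w` with `b c < a d` has a zero with `z = i` and
`Im w > 0`. -/
lemma im_neg_div_pos {a b c d : ℝ} (h : b * c < a * d) :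
    0 < (-((a : ℂ) + Complex.I * b) / ((c : ℂ) + Complex.I * d)).im := by
  have hcd : 0 < c * c + d * d := by
    rcases eq_or_ne d 0 with rfl | hd
    · have hc : c ≠ 0 := by rintro rfl; simp at h
      nlinarith [mul_self_pos.2 hc]
    · nlinarith [mul_self_pos.2 hd, mul_self_nonneg c]
  have heq : (-((a : ℂ) + Complex.I * b) / ((c : ℂ) + Complex.I * d)).im =
      (a * d - b * c) / (c * c + d * d) := by
    rw [Complex.div_im]
    simp only [Complex.neg_im, Complex.neg_re, Complex.add_re, Complex.add_im, Complex.mul_re,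
      Complex.mul_im, Complex.I_re, Complex.I_im, Complex.ofReal_re, Complex.ofReal_im,
      Complex.normSq_apply]
    ring
  rw [heq]
  exact div_pos (by linarith) hcd

/-- The Rayleigh inequality for real stable multiaffine polynomials. -/
lemma StronglyRayleigh.rayleigh {n k : ℕ} {μ : Finset (Fin n) → ℝ} (hμ : StronglyRayleigh n k μ)
    {e t : Fin n} (het : e ≠ t) (x : Fin n → ℝ) :
    multiaffineDeriv n k μ ∅ x * multiaffineDeriv n k μ {e, t} x ≤
      multiaffineDeriv n k μ {e} x * multiaffineDeriv n k μ {t} x := by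
  set a := multiaffineDeriv n k μ ∅ (Function.update (Function.update x e 0) t 0) with ha
  set b := multiaffineDeriv n k μ {e} (Function.update x t 0) with hb
  set c := multiaffineDeriv n k μ {t} (Function.update x e 0) with hc
  set d := multiaffineDeriv n k μ {e, t} x with hd
  have hE := multiaffineDeriv_eq_add (k := k) μ (A := {e}) (t := t) (by simpa using het.symm) x
  have hT := multiaffineDeriv_eq_add (k := k) μ (A := {t}) (t := e) (by simpa using het) x
  rw [pair_comm t e] at hE
  rw [multiaffineDeriv_empty_eq μ het x, hE, hT, ← ha, ← hb, ← hc, ← hd]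
  suffices h : a * d ≤ b * c by linarith
  by_contra! hlt
  let m : Finset (Fin n) → ℂ := fun S => (μ S : ℂ)
  let z : ℝ → Fin n → ℂ := fun ε i => x i + Complex.I * ε
  let p : ℝ → ℂ := fun ε =>
    multiaffineDeriv n k m ∅ (Function.update (Function.update (z ε) e 0) t 0) +
      Complex.I * multiaffineDeriv n k m {e} (Function.update (z ε) t 0)
  let q : ℝ → ℂ := fun ε =>
    multiaffineDeriv n k m {t} (Function.update (z ε) e 0) +
      Complex.I * multiaffineDeriv n k m {e, t} (z ε)
  have hz : Continuous z := by fun_prop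
  have hD := fun A => continuous_multiaffineDeriv (k := k) m A
  have hp : Continuous p :=
    ((hD _).comp ((hz.update e continuous_const).update t continuous_const)).add
      (continuous_const.mul ((hD _).comp (hz.update t continuous_const)))
  have hq : Continuous q :=
    ((hD _).comp (hz.update e continuous_const)).add
      (continuous_const.mul ((hD _).comp hz))
  have hz0 : z 0 = fun i => (x i : ℂ) := by ext i; simp [z]
  have hupd : ∀ (y : Fin n → ℝ) (j : Fin n), Function.update (fun i => (y i : ℂ)) j 0 =
      fun i => ((Function.update y j 0 i : ℝ) : ℂ) := by
    intro y j
    ext i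
    by_cases hij : i = j
    · subst hij; simp
    · simp [Function.update_of_ne hij]
  have hp0 : p 0 = a + Complex.I * b := by
    simp only [p, hz0, hupd, m, multiaffineDeriv_ofReal, ha, hb]
  have hq0 : q 0 = c + Complex.I * d := by
    simp only [q, hz0, hupd, m, multiaffineDeriv_ofReal, hc, hd]
  have him : 0 < (-p 0 / q 0).im := by
    rw [hp0, hq0]
    exact im_neg_div_pos hlt
  have hq0' : q 0 ≠ 0 := by
    intro h
    simp [h] at him
  have hw : ContinuousAt (fun ε => (-p ε / q ε).im) 0 :=
    Complex.continuous_im.continuousAt.comp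
      (hp.neg.continuousAt.div hq.continuousAt hq0')
  have hev := (hw.eventually (lt_mem_nhds him)).filter_mono
    (nhdsWithin_le_nhds (s := Set.Ioi (0 : ℝ)))
  obtain ⟨ε, hεim, hεpos⟩ := (hev.and self_mem_nhdsWithin).exists
  have hεpos : 0 < ε := hεpos
  have hqε : q ε ≠ 0 := by
    intro h
    simp [h] at hεim
  let y : Fin n → ℂ := Function.update (Function.update (z ε) e Complex.I) t (-p ε / q ε)
  refine hμ.2 y ?_ ?_
  · intro i
    by_cases hit : i = t
    · subst hit; simpa [y] using hεim
    by_cases hie : i = e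
    · subst hie; simp [y, Function.update_of_ne hit]
    · simpa [y, Function.update_of_ne hit, Function.update_of_ne hie, z] using hεpos
  · have key := multiaffineDeriv_empty_eq (k := k) m het y
    have hye : y e = Complex.I := by simp [y, Function.update_of_ne het]
    have hyt : y t = -p ε / q ε := by simp [y]
    have h1 : Function.update (Function.update y e 0) t 0 =
        Function.update (Function.update (z ε) e 0) t 0 := by
      ext i
      simp only [y, Function.update_apply]
      split_ifs <;> rfl
    have h2 : multiaffineDeriv n k m {e} (Function.update y t 0) =
        multiaffineDeriv n k m {e} (Function.update (z ε) t 0) := by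
      refine multiaffineDeriv_congr _ _ fun i hi => ?_
      simp only [mem_singleton] at hi
      simp only [y, Function.update_apply, if_neg hi]
      split_ifs <;> rfl
    have h3 : multiaffineDeriv n k m {t} (Function.update y e 0) =
        multiaffineDeriv n k m {t} (Function.update (z ε) e 0) := by
      refine multiaffineDeriv_congr _ _ fun i hi => ?_
      simp only [mem_singleton] at hi
      simp only [y, Function.update_apply, if_neg hi]
      split_ifs <;> rfl
    have h4 : multiaffineDeriv n k m {e, t} y = multiaffineDeriv n k m {e, t} (z ε) := by
      refine multiaffineDeriv_congr _ _ fun i hi => ?_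
      simp only [mem_insert, mem_singleton, not_or] at hi
      simp only [y, Function.update_apply, if_neg hi.1, if_neg hi.2]
    rw [h1, h2, h3, h4, hye, hyt] at key
    have hzero : multiaffineDeriv n k m ∅ y = 0 := by
      rw [key]
      have h : p ε + -p ε / q ε * q ε = 0 := by rw [div_mul_cancel₀ _ hqε, add_neg_cancel]
      generalize -p ε / q ε = w at h
      simp only [p, q] at h
      linear_combination h
    simpa [multiaffineDeriv, m] using hzero

lemma mul_le_mul_of_forall_affine {a₀ a₁ b₀ b₁ c₀ c₁ d₀ d₁ : ℝ}
    (h : ∀ M : ℝ, (a₀ + M * a₁) * (d₀ + M * d₁) ≤ (b₀ + M * b₁) * (c₀ + M * c₁)) :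
    a₁ * d₁ ≤ b₁ * c₁ := by
  by_contra! hlt
  set δ := a₁ * d₁ - b₁ * c₁ with hδ
  set σ := a₀ * d₁ + a₁ * d₀ - b₀ * c₁ - b₁ * c₀ with hσ
  set τ := a₀ * d₀ - b₀ * c₀ with hτ
  have hδpos : 0 < δ := by linarith
  have hM : ∀ M : ℝ, M * M * δ + M * σ + τ ≤ 0 := fun M => by
    rw [hδ, hσ, hτ]; linarith [h M]
  set M := (|σ| + |τ| + 1) / δ + 1 with hMdef
  have hMδ : M * δ = |σ| + |τ| + 1 + δ := by rw [hMdef]; field_simp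
  have hM1 : 1 ≤ M := by
    rw [hMdef]
    exact le_add_of_nonneg_left (by positivity)
  have h1 := hM M
  have h2 : M * M * δ + M * σ = M * (|σ| + |τ| + 1 + δ + σ) := by rw [← hMδ]; ring
  nlinarith [neg_abs_le σ, neg_abs_le τ, abs_nonneg τ]

/-- The Rayleigh inequality is inherited by partial derivatives. -/
lemma StronglyRayleigh.rayleigh_deriv {n k : ℕ} {μ : Finset (Fin n) → ℝ}
    (hμ : StronglyRayleigh n k μ) {e t : Fin n} (het : e ≠ t) (A : Finset (Fin n))
    (heA : e ∉ A) (htA : t ∉ A) (x : Fin n → ℝ) :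
    multiaffineDeriv n k μ A x * multiaffineDeriv n k μ (insert e (insert t A)) x ≤
      multiaffineDeriv n k μ (insert e A) x * multiaffineDeriv n k μ (insert t A) x := by
  induction A using Finset.induction_on generalizing x with
  | empty => simpa using hμ.rayleigh het x
  | insert r A hr ih =>
    simp only [mem_insert, not_or] at heA htA
    have hsplit : ∀ B : Finset (Fin n), r ∉ B → ∀ M : ℝ,
        multiaffineDeriv n k μ B (Function.update x r M) =
          multiaffineDeriv n k μ B (Function.update x r 0) +
            M * multiaffineDeriv n k μ (insert r B) x := by
      intro B hB M
      rw [multiaffineDeriv_eq_add μ hB, Function.update_idem, Function.update_self]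
      congr 2
      refine multiaffineDeriv_congr _ _ fun i hi => ?_
      rw [Function.update_of_ne]
      rintro rfl
      exact hi (mem_insert_self _ _)
    rw [insert_comm t r A, insert_comm e r (insert t A), insert_comm e r A]
    set x₀ := Function.update x r 0
    refine mul_le_mul_of_forall_affine (a₀ := multiaffineDeriv n k μ A x₀)
      (b₀ := multiaffineDeriv n k μ (insert e A) x₀)
      (c₀ := multiaffineDeriv n k μ (insert t A) x₀)
      (d₀ := multiaffineDeriv n k μ (insert e (insert t A)) x₀) fun M => ?_
    rw [← hsplit A hr, ← hsplit (insert e A) (by simp [hr, Ne.symm heA.1]),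
      ← hsplit (insert t A) (by simp [hr, Ne.symm htA.1]),
      ← hsplit (insert e (insert t A)) (by simp [hr, Ne.symm htA.1, Ne.symm heA.1])]
    exact ih heA.2 htA.2 _

lemma multiaffineDeriv_indicator {n k : ℕ} (μ : Finset (Fin n) → ℝ) (A U : Finset (Fin n)) :
    multiaffineDeriv n k μ A (fun i => if i ∈ U then 1 else 0) =
      ∑ S ∈ (powersetCard k (univ : Finset (Fin n))).filter (fun S => A ⊆ S ∧ S \ A ⊆ U),
        μ S := by
  unfold multiaffineDeriv
  rw [← filter_filter, sum_filter (s := filter _ _)]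
  refine sum_congr rfl fun S _ => ?_
  rw [prod_ite_zero]
  simp [subset_iff]

/-- With external field the indicator of a `k`-set `U`, conditioning on containing `T` can only
decrease the relative weight of an element `e ∉ T`. -/
lemma StronglyRayleigh.negative_dependence {n k : ℕ} {μ : Finset (Fin n) → ℝ}
    (hμ : StronglyRayleigh n k μ) (hfull : ∀ S : Finset (Fin n), S.card = k → 0 < μ S)
    {U : Finset (Fin n)} (hU : U.card = k) {e : Fin n} (T : Finset (Fin n))
    (hT : T.card ≤ k) (heT : e ∉ T) :
    let x : Fin n → ℝ := fun i => if i ∈ U then 1 else 0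
    multiaffineDeriv n k μ (insert e T) x * multiaffineDeriv n k μ ∅ x ≤
      multiaffineDeriv n k μ {e} x * multiaffineDeriv n k μ T x := by
  intro x
  induction T using Finset.induction_on with
  | empty => simp
  | insert t T ht ih =>
    rw [card_insert_of_notMem ht] at hT
    simp only [mem_insert, not_or] at heT
    have h1 := ih (by omega) heT.2
    have h2 := hμ.rayleigh_deriv heT.1 T heT.2 ht x
    have hnn : ∀ A, 0 ≤ multiaffineDeriv n k μ A x := fun A => by
      rw [multiaffineDeriv_indicator]
      refine sum_nonneg fun S hS => (hfull S ?_).le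
      exact (mem_powersetCard.1 (mem_filter.1 hS).1).2
    have hpos : 0 < multiaffineDeriv n k μ T x := by
      rw [multiaffineDeriv_indicator]
      refine sum_pos (fun S hS => hfull S (mem_powersetCard.1 (mem_filter.1 hS).1).2) ?_
      obtain ⟨S, hTS, hSU, hS⟩ := exists_subsuperset_card_eq (s := T) (t := T ∪ U) (n := k)
        subset_union_left (by omega) (hU ▸ card_le_card subset_union_right)
      refine ⟨S, mem_filter.2 ⟨mem_powersetCard.2 ⟨subset_univ _, hS⟩, hTS, ?_⟩⟩
      exact sdiff_le_iff.2 hSU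
    refine le_of_mul_le_mul_left ?_ hpos
    calc _ = (multiaffineDeriv n k μ T x * multiaffineDeriv n k μ (insert e (insert t T)) x) *
          multiaffineDeriv n k μ ∅ x := by ring
      _ ≤ (multiaffineDeriv n k μ (insert e T) x * multiaffineDeriv n k μ (insert t T) x) *
          multiaffineDeriv n k μ ∅ x := mul_le_mul_of_nonneg_right h2 (hnn _)
      _ = (multiaffineDeriv n k μ (insert e T) x * multiaffineDeriv n k μ ∅ x) *
          multiaffineDeriv n k μ (insert t T) x := by ring
      _ ≤ (multiaffineDeriv n k μ {e} x * multiaffineDeriv n k μ T x) *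
          multiaffineDeriv n k μ (insert t T) x := mul_le_mul_of_nonneg_right h1 (hnn _)
      _ = _ := by ring

/-- Elements of `V` outside an approximate local optimum `U` of `V` can be exchanged for
elements of `U` at a bounded loss. -/
lemma StronglyRayleigh.exists_exchange {n k : ℕ} {μ : Finset (Fin n) → ℝ}
    (hμ : StronglyRayleigh n k μ) (hfull : ∀ S : Finset (Fin n), S.card = k → 0 < μ S)
    {ζ : ℝ} {V U : Finset (Fin n)} (hU : ApproxLocalOpt n k ζ μ V U)
    {S : Finset (Fin n)} (hS : S.card = k) {e : Fin n} (heS : e ∈ S) (heV : e ∈ V)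
    (heU : e ∉ U) :
    ∃ f ∈ U, f ∉ S ∧ μ S ≤ ζ * k ^ 2 * μ (insert f (S.erase e)) := by
  obtain ⟨hUV, hUk, hopt⟩ := hU
  set T := S.erase e with hTdef
  have hTk : T.card + 1 = k := by rw [← hS]; exact card_erase_add_one heS
  have heT : e ∉ T := notMem_erase e S
  have hST : insert e T = S := insert_erase heS
  have key := hμ.negative_dependence hfull hUk T (by omega) heT
  simp only [multiaffineDeriv_indicator] at key
  have hne : (U \ T).Nonempty := by
    rw [← card_pos]
    have := le_card_sdiff T U
    omega
  obtain ⟨f, hf, hmax⟩ := exists_max_image (U \ T) (fun f => μ (insert f T)) hne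
  rw [mem_sdiff] at hf
  have hμU := hfull U hUk
  have hS_sum : μ S ≤ ∑ W ∈ (powersetCard k (univ : Finset (Fin n))).filter
      (fun W => insert e T ⊆ W ∧ W \ insert e T ⊆ U), μ W := by
    refine single_le_sum (f := μ) (fun W hW =>
      (hfull W (mem_powersetCard.1 (mem_filter.1 hW).1).2).le) ?_
    simp [hST, hS]
  have hU_sum : μ U ≤ ∑ W ∈ (powersetCard k (univ : Finset (Fin n))).filter
      (fun W => ∅ ⊆ W ∧ W \ ∅ ⊆ U), μ W := by
    refine single_le_sum (f := μ) (fun W hW =>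
      (hfull W (mem_powersetCard.1 (mem_filter.1 hW).1).2).le) ?_
    simp [hUk]
  have hT_sum : ∑ W ∈ (powersetCard k (univ : Finset (Fin n))).filter
      (fun W => T ⊆ W ∧ W \ T ⊆ U), μ W ≤ k * μ (insert f T) := by
    have hsub : (powersetCard k (univ : Finset (Fin n))).filter
        (fun W => T ⊆ W ∧ W \ T ⊆ U) ⊆ (U \ T).image (fun g => insert g T) := by
      intro W hW
      simp only [mem_filter, mem_powersetCard] at hW
      obtain ⟨⟨-, hWk⟩, hTW, hWU⟩ := hW
      have hcard : (W \ T).card = 1 := by rw [card_sdiff_of_subset hTW]; omega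
      obtain ⟨g, hg⟩ := card_eq_one.1 hcard
      have hgW : g ∈ W \ T := by rw [hg]; exact mem_singleton_self g
      refine mem_image.2 ⟨g, mem_sdiff.2 ⟨hWU hgW, (mem_sdiff.1 hgW).2⟩, ?_⟩
      rw [insert_eq, ← hg, sdiff_union_of_subset hTW]
    have hcard := (card_le_card hsub).trans (card_image_le.trans (card_le_card sdiff_subset))
    rw [hUk] at hcard
    calc _ ≤ ∑ W ∈ (powersetCard k (univ : Finset (Fin n))).filter
          (fun W => T ⊆ W ∧ W \ T ⊆ U), μ (insert f T) := by
            refine sum_le_sum fun W hW => ?_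
            obtain ⟨g, hg, rfl⟩ := mem_image.1 (hsub hW)
            exact hmax g hg
      _ ≤ k * μ (insert f T) := by
            rw [sum_const, nsmul_eq_mul]
            refine mul_le_mul_of_nonneg_right (by exact_mod_cast hcard) (hfull _ ?_).le
            rw [card_insert_of_notMem hf.2, hTk]
  have he_sum : ∑ W ∈ (powersetCard k (univ : Finset (Fin n))).filter
      (fun W => {e} ⊆ W ∧ W \ {e} ⊆ U), μ W ≤ k * (ζ * μ U) := by
    have hsub : (powersetCard k (univ : Finset (Fin n))).filter
        (fun W => {e} ⊆ W ∧ W \ {e} ⊆ U) ⊆ U.image (fun g => insert e (U.erase g)) := by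
      intro W hW
      simp only [mem_filter, mem_powersetCard, singleton_subset_iff, sdiff_singleton_eq_erase]
        at hW
      obtain ⟨⟨-, hWk⟩, heW, hWU⟩ := hW
      have hcard : (U \ W.erase e).card = 1 := by
        rw [card_sdiff_of_subset hWU, card_erase_of_mem heW]; omega
      obtain ⟨g, hg⟩ := card_eq_one.1 hcard
      have hgU : g ∈ U \ W.erase e := by rw [hg]; exact mem_singleton_self g
      refine mem_image.2 ⟨g, (mem_sdiff.1 hgU).1, ?_⟩
      rw [← sdiff_singleton_eq_erase, ← hg, Finset.sdiff_sdiff_eq_self hWU, insert_erase heW]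
    have hcard := (card_le_card hsub).trans card_image_le
    rw [hUk] at hcard
    calc _ ≤ ∑ W ∈ (powersetCard k (univ : Finset (Fin n))).filter
          (fun W => {e} ⊆ W ∧ W \ {e} ⊆ U), ζ * μ U := by
            refine sum_le_sum fun W hW => ?_
            obtain ⟨g, hg, rfl⟩ := mem_image.1 (hsub hW)
            exact hopt g hg e (mem_sdiff.2 ⟨heV, heU⟩)
      _ ≤ k * (ζ * μ U) := by
            rw [sum_const, nsmul_eq_mul]
            refine mul_le_mul_of_nonneg_right (by exact_mod_cast hcard) ?_
            obtain ⟨g, hg⟩ := hne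
            have hgU := (mem_sdiff.1 hg).1
            refine (hfull (insert e (U.erase g)) ?_).le.trans
              (hopt g hgU e (mem_sdiff.2 ⟨heV, heU⟩))
            rw [card_insert_of_notMem (fun h => heU (mem_of_mem_erase h)),
              card_erase_add_one hgU, hUk]
  refine ⟨f, hf.1, ?_, ?_⟩
  · intro hfS
    refine hf.2 (mem_erase.2 ⟨?_, hfS⟩)
    rintro rfl
    exact heU hf.1
  · refine le_of_mul_le_mul_right ?_ hμU
    have hnn : ∀ A : Finset (Fin n), 0 ≤ ∑ W ∈ (powersetCard k (univ : Finset (Fin n))).filter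
        (fun W => A ⊆ W ∧ W \ A ⊆ U), μ W := fun A => sum_nonneg fun W hW =>
      (hfull W (mem_powersetCard.1 (mem_filter.1 hW).1).2).le
    calc μ S * μ U ≤ _ := mul_le_mul hS_sum hU_sum hμU.le (hnn _)
      _ ≤ _ := key
      _ ≤ k * (ζ * μ U) * (k * μ (insert f T)) :=
        mul_le_mul he_sum hT_sum (hnn _) ((hnn _).trans he_sum)
      _ = _ := by ring

/-- for a full-support strongly Rayleigh `μ` on `k`-subsets and a
partition matroid with parts `P_1, …, P_s`, quotas `k_i ≥ 1`, rank `k = Σ k_i`, the map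
sending `V` to the union over `i` of a `k`-element `ζ`-approximate local optimum of `μ`
inside `V ∩ P_i` (or all of `V ∩ P_i` when `|V ∩ P_i| < k`) has size at most `sk` and
is a `(ζk)^{2k}`-composable coreset for the restriction `μ_M` of `μ` to bases. -/
theorem stmt9 (n s k : ℕ) (hk1 : 1 ≤ k) (hkn : k ≤ n)
    (μ : Finset (Fin n) → ℝ) (hμ : StronglyRayleigh n k μ)
    (hfull : ∀ S : Finset (Fin n), S.card = k → 0 < μ S)
    (ζ : ℝ) (hζ : 1 ≤ ζ)
    (P : Fin s → Finset (Fin n))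
    (hPdisj : ∀ i j : Fin s, i ≠ j → Disjoint (P i) (P j))
    (hPcover : Finset.univ.biUnion P = (Finset.univ : Finset (Fin n)))
    (kk : Fin s → ℕ) (hkk : ∀ i, 1 ≤ kk i) (hsum : ∑ i, kk i = k)
    (c : Finset (Fin n) → Finset (Fin n))
    (hc : ∀ V : Finset (Fin n), ∃ Us : Fin s → Finset (Fin n),
      (∀ i, (k ≤ (V ∩ P i).card → ApproxLocalOpt n k ζ μ (V ∩ P i) (Us i)) ∧
            ((V ∩ P i).card < k → Us i = V ∩ P i)) ∧
      c V = Finset.univ.biUnion Us) :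
    (∀ V, (c V).card ≤ s * k) ∧
    ComposableCoreset n k ((ζ * k) ^ (2 * k))
      (fun S => if ∀ i, (S ∩ P i).card = kk i then μ S else 0) c := by
  choose Us hUs hcV using hc
  have hUsub : ∀ V i, Us V i ⊆ V ∩ P i := fun V i => by
    rcases le_or_gt k (V ∩ P i).card with h | h
    · exact ((hUs V i).1 h).1
    · exact ((hUs V i).2 h).subset
  have hUcard : ∀ V i, (Us V i).card ≤ k := fun V i => by
    rcases le_or_gt k (V ∩ P i).card with h | h
    · exact ((hUs V i).1 h).2.1.le
    · rw [(hUs V i).2 h]; exact h.le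
  refine ⟨fun V => ?_, fun V => ?_, fun m Vs S hSV hSk => ?_⟩
  · rw [hcV]
    simpa using card_biUnion_le_card_mul univ (Us V) k fun i _ => hUcard V i
  · rw [hcV]
    exact biUnion_subset.2 fun i _ => (hUsub V i).trans inter_subset_left
  set C := univ.biUnion fun i => c (Vs i) with hC
  have hUC : ∀ j i, Us (Vs j) i ⊆ C := fun j i f hf =>
    mem_biUnion.2 ⟨j, mem_univ j, by rw [hcV]; exact mem_biUnion.2 ⟨i, mem_univ i, hf⟩⟩
  have hlocal : ∀ e ∈ univ.biUnion Vs, e ∉ C → ∃ j i, e ∈ Vs j ∩ P i ∧ e ∉ Us (Vs j) i ∧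
      ApproxLocalOpt n k ζ μ (Vs j ∩ P i) (Us (Vs j) i) := by
    intro e heV heC
    obtain ⟨j, -, hj⟩ := mem_biUnion.1 heV
    obtain ⟨i, -, hi⟩ := mem_biUnion.1 (hPcover.symm ▸ mem_univ e)
    have heU : e ∉ Us (Vs j) i := fun h => heC (hUC j i h)
    have he : e ∈ Vs j ∩ P i := mem_inter.2 ⟨hj, hi⟩
    refine ⟨j, i, he, heU, (hUs (Vs j) i).1 ?_⟩
    by_contra! h
    exact heU ((hUs (Vs j) i).2 h ▸ he)
  have hkR : (1 : ℝ) ≤ k := by exact_mod_cast hk1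
  set β : ℝ := (ζ * k) ^ 2 with hβ
  have hζk : 1 ≤ ζ * k := one_le_mul_of_one_le_of_one_le hζ hkR
  have hβ1 : 1 ≤ β := one_le_pow₀ hζk
  have hζβ : ζ * k ^ 2 ≤ β := by
    rw [hβ, mul_pow]
    exact mul_le_mul_of_nonneg_right (le_self_pow₀ hζ two_ne_zero) (by positivity)
  rw [pow_mul, ← hβ]
  by_cases hbasis : ∀ i, (S ∩ P i).card = kk i
  · have main : ∀ (N : ℕ) (S : Finset (Fin n)), (S \ C).card = N → S ⊆ univ.biUnion Vs →
        S.card = k → (∀ i, (S ∩ P i).card = kk i) →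
        ∃ T ⊆ C, T.card = k ∧ (∀ i, (T ∩ P i).card = kk i) ∧ μ S ≤ β ^ N * μ T := by
      intro N
      induction N with
      | zero =>
        intro S hN _ hSk hb
        exact ⟨S, sdiff_eq_empty_iff_subset.1 (card_eq_zero.1 hN), hSk, hb, by simp⟩
      | succ N ih =>
        intro S hN hSV hSk hb
        obtain ⟨e, he⟩ : (S \ C).Nonempty := card_pos.1 (by omega)
        obtain ⟨heS, heC⟩ := mem_sdiff.1 he
        obtain ⟨j, i, hei, heU, hopt⟩ := hlocal e (hSV heS) heC
        obtain ⟨f, hfU, hfS, hle⟩ := hμ.exists_exchange hfull hopt hSk heS hei heU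
        have hfe : f ∉ S.erase e := fun h => hfS (mem_of_mem_erase h)
        have hfi := hUsub _ _ hfU
        have hSk' : (insert f (S.erase e)).card = k := by
          rw [card_insert_of_notMem hfe, card_erase_add_one heS, hSk]
        obtain ⟨T, hTC, hTk, hTb, hT⟩ := ih (insert f (S.erase e)) (by
          rw [insert_sdiff_of_mem _ (hUC j i hfU), erase_sdiff_comm, card_erase_of_mem he, hN]
          rfl) (by
          refine insert_subset ?_ ((erase_subset _ _).trans hSV)
          exact mem_biUnion.2 ⟨j, mem_univ j, (mem_inter.1 hfi).1⟩) hSk' (by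
          intro l
          rw [← hb l]
          by_cases hl : l = i
          · subst hl
            rw [insert_inter_of_mem (mem_inter.1 hfi).2, erase_inter,
              card_insert_of_notMem (fun h => hfS (mem_inter.1 (mem_of_mem_erase h)).1),
              card_erase_add_one (mem_inter.2 ⟨heS, (mem_inter.1 hei).2⟩)]
          · have hd := disjoint_left.1 (hPdisj i l (Ne.symm hl))
            rw [insert_inter_of_notMem (hd (mem_inter.1 hfi).2), erase_inter,
              erase_eq_of_notMem fun h => hd (mem_inter.1 hei).2 (mem_inter.1 h).2])
        refine ⟨T, hTC, hTk, hTb, ?_⟩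
        calc μ S ≤ ζ * k ^ 2 * μ (insert f (S.erase e)) := hle
          _ ≤ β * (β ^ N * μ T) :=
            mul_le_mul hζβ hT (hfull _ hSk').le (zero_le_one.trans hβ1)
          _ = β ^ (N + 1) * μ T := by ring
    obtain ⟨T, hTC, hTk, hTb, hT⟩ := main _ S rfl hSV hSk hbasis
    refine ⟨T, hTC, hTk, ?_⟩
    simp only [if_pos hbasis, if_pos hTb]
    refine hT.trans (mul_le_mul_of_nonneg_right (pow_le_pow_right₀ hβ1 ?_) (hfull T hTk).le)
    exact hSk ▸ card_le_card sdiff_subset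
  · have hnn : ∀ T : Finset (Fin n), T.card = k →
        0 ≤ β ^ k * if ∀ i, (T ∩ P i).card = kk i then μ T else 0 := fun T hT => by
      refine mul_nonneg (pow_nonneg (zero_le_one.trans hβ1) k) ?_
      split_ifs
      exacts [(hfull T hT).le, le_rfl]
    simp only [if_neg hbasis]
    by_cases hSC : S ⊆ C
    · exact ⟨S, hSC, hSk, hnn S hSk⟩
    · obtain ⟨e, heS, heC⟩ := not_subset.1 hSC
      obtain ⟨j, i, -, -, hopt⟩ := hlocal e (hSV heS) heC
      exact ⟨Us (Vs j) i, hUC j i, hopt.2.1, hnn _ hopt.2.1⟩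
end
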